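/- arXiv:2407.20677 — 2 statements merged into one kernel-verified Lean document; each statement's English description precedes it below -/
import Mathlib

section
/- Let N, K, n be natural numbers with 2K ≤ N, 2n ≥ N, and n ≤ N. Then for every nonzero complex number z, the probability-generating function of the hypergeometric distribution satisfies ∑_{k=0}^{n} (C(K,k)·C(N−K,n−k)/C(N,n))·z^k = (n!·(N−K)!)/(N!·(n−K)!) · z^K · ∑_{j=0}^{min(N−n,K)} ((n−N)_j·(−K)_j)/((n−K+1)_j · j!) · z^{−j}. -/
open Finset Nat

/-- The rising factorial of a negated natural number, as a signed quotient of factorials. -/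
theorem ascPochhammer_eval_neg_natCast_add (j b : ℕ) :
    (ascPochhammer ℂ j).eval (-((j + b : ℕ) : ℂ)) = (-1) ^ j * (((j + b)! : ℂ) / (b ! : ℂ)) := by
  have hb : (b ! : ℂ) ≠ 0 := Nat.cast_ne_zero.mpr b.factorial_ne_zero
  have h := Nat.factorial_mul_descFactorial (Nat.le_add_right j b)
  rw [Nat.add_sub_cancel_left] at h
  rw [ascPochhammer_eval_neg_eq_descPochhammer, descPochhammer_eval_eq_descFactorial, ← h]
  push_cast
  field_simp

/-- The rising factorial of a positive natural number, as a quotient of factorials. -/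
theorem ascPochhammer_eval_natCast_add_one (m j : ℕ) :
    (ascPochhammer ℂ j).eval ((m : ℂ) + 1) = ((m + j)! : ℂ) / (m ! : ℂ) := by
  have hm : (m ! : ℂ) ≠ 0 := Nat.cast_ne_zero.mpr m.factorial_ne_zero
  have h : (ascPochhammer ℂ j).eval ((m + 1 : ℕ) : ℂ) = ((m + 1).ascFactorial j : ℂ) := by
    rw [← ascPochhammer_eval_cast, ascPochhammer_nat_eq_ascFactorial]
  rw [← Nat.factorial_mul_ascFactorial m j, ← Nat.cast_add_one, h]
  push_cast
  field_simp

/-- The `k = K - j` term of the probability-generating function, in Pochhammer form. -/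
theorem hypergeometric_pgf_term {N K n j : ℕ} (hKn : K ≤ n) (hnN : n ≤ N) (hjK : j ≤ K)
    (hjN : j ≤ N - n) {z : ℂ} (hz : z ≠ 0) :
    ((K.choose (K - j) : ℂ) * ((N - K).choose (n - (K - j)) : ℂ) / (N.choose n : ℂ)) * z ^ (K - j)
    = (n ! : ℂ) * ((N - K)! : ℂ) / ((N ! : ℂ) * ((n - K)! : ℂ)) * z ^ K *
        (((ascPochhammer ℂ j).eval ((n : ℂ) - (N : ℂ)) * (ascPochhammer ℂ j).eval (-(K : ℂ))) /
          ((ascPochhammer ℂ j).eval ((n : ℂ) - (K : ℂ) + 1) * (j ! : ℂ)) * z ^ (-(j : ℤ))) := by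
  obtain ⟨a, rfl⟩ := Nat.exists_eq_add_of_le hjK
  obtain ⟨m, rfl⟩ := Nat.exists_eq_add_of_le hKn
  obtain ⟨c, rfl⟩ := Nat.exists_eq_add_of_le hnN
  rw [Nat.add_sub_cancel_left] at hjN
  obtain ⟨b, rfl⟩ := Nat.exists_eq_add_of_le hjN
  have e₁ : ((j + a + m : ℕ) : ℂ) - ((j + a + m + (j + b) : ℕ) : ℂ) = -((j + b : ℕ) : ℂ) := by
    push_cast; ring
  have e₂ : ((j + a + m : ℕ) : ℂ) - ((j + a : ℕ) : ℂ) + 1 = (m : ℂ) + 1 := by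
    push_cast; ring
  rw [e₁, e₂, ascPochhammer_eval_neg_natCast_add, ascPochhammer_eval_neg_natCast_add,
    ascPochhammer_eval_natCast_add_one, zpow_neg, zpow_natCast,
    show j + a - j = a by omega, show j + a + m - a = m + j by omega,
    show j + a + m - (j + a) = m by omega,
    show j + a + m + (j + b) - (j + a) = m + j + b by omega,
    Nat.cast_choose ℂ (Nat.le_add_left a j), Nat.cast_choose ℂ (Nat.le_add_right (m + j) b),
    Nat.cast_choose ℂ (Nat.le_add_right (j + a + m) (j + b)),
    Nat.add_sub_cancel, Nat.add_sub_cancel_left, Nat.add_sub_cancel_left, pow_add]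
  have hf (i : ℕ) : (i ! : ℂ) ≠ 0 := Nat.cast_ne_zero.mpr i.factorial_ne_zero
  have hs : ((-1 : ℂ) ^ j) * (-1) ^ j = 1 := by rw [← mul_pow]; simp
  have := hf a
  have := hf b
  have := hf j
  have := hf m
  have := hf (j + a)
  have := hf (j + b)
  have := hf (m + j)
  have := hf (m + j + b)
  have := hf (j + a + m)
  have := hf (j + a + m + (j + b))
  rw [mul_mul_mul_comm ((-1 : ℂ) ^ j), hs]
  field_simp

theorem hypergeometric_pgf_symmetric_form_a (N K n : ℕ) (hK : 2 * K ≤ N) (hn : N ≤ 2 * n)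
    (hnN : n ≤ N) (z : ℂ) (hz : z ≠ 0) :
    ∑ k ∈ Finset.range (n + 1),
        ((K.choose k : ℂ) * ((N - K).choose (n - k) : ℂ) / (N.choose n : ℂ)) * z ^ k
    = (n ! : ℂ) * ((N - K)! : ℂ) / ((N ! : ℂ) * ((n - K)! : ℂ)) * z ^ K *
      ∑ j ∈ Finset.range (min (N - n) K + 1),
        ((ascPochhammer ℂ j).eval ((n : ℂ) - (N : ℂ)) * (ascPochhammer ℂ j).eval (-(K : ℂ))) /
          ((ascPochhammer ℂ j).eval ((n : ℂ) - (K : ℂ) + 1) * (j ! : ℂ)) *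
          z ^ (-(j : ℤ)) := by
  have hKn : K ≤ n := by omega
  have hupper : ∀ k ∈ Finset.range (n + 1), k ∉ Finset.range (K + 1) →
      ((K.choose k : ℂ) * ((N - K).choose (n - k) : ℂ) / (N.choose n : ℂ)) * z ^ k = 0 := by
    intro k _ hk
    rw [Finset.mem_range] at hk
    simp [Nat.choose_eq_zero_of_lt (show K < k by omega)]
  rw [← Finset.sum_subset (Finset.range_mono (by omega)) hupper, ← Finset.sum_range_reflect,
    Finset.mul_sum]
  symm
  refine Finset.sum_subset_zero_on_sdiff (Finset.range_mono (by omega)) ?_ ?_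
  · intro j hj
    simp only [Finset.mem_sdiff, Finset.mem_range] at hj
    simp [Nat.choose_eq_zero_of_lt (show N - K < n - (K - j) by omega)]
  · intro j hj
    rw [Finset.mem_range] at hj
    rw [Nat.add_sub_cancel]
    exact (hypergeometric_pgf_term hKn hnN (by omega) (by omega) hz).symm
end

section
/- Let N, K, n, r be natural numbers with K ≤ N, n ≤ N, n ≥ N − K + 1, and r ≤ min(n, K). Then the r-th derivative at z = 1 of the polynomial z ↦ (n!·K!)/(N!·(n+K−N)!) · z^{n+K−N} · ∑_{j=0}^{min(N−n,N−K)} ((n−N)_j·(K−N)_j)/((n+K−N+1)_j · j!) · z^j equals (n!·K!·(N−r)!)/((n−r)!·(K−r)!·N!), i.e., the r-th factorial moment computed from the corrected generating-function formula agrees with the classical factorial-moment formula of the hypergeometric distribution. -/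
open Finset Nat

theorem sum_choose_mul_choose_mul_descFactorial (K M n r : ℕ) (hrK : r ≤ K) (hrn : r ≤ n) :
    ∑ k ∈ Finset.range (n + 1), K.choose k * M.choose (n - k) * k.descFactorial r
      = K.descFactorial r * (K + M - r).choose (n - r) := by
  obtain ⟨s, rfl⟩ := Nat.exists_eq_add_of_le hrn
  obtain ⟨L, rfl⟩ := Nat.exists_eq_add_of_le hrK
  rw [add_assoc r s 1, Finset.sum_range_add, Finset.sum_eq_zero, zero_add,
    show r + L + M - r = L + M by lia, Nat.add_sub_cancel_left, Nat.add_choose_eq,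
    Finset.Nat.sum_antidiagonal_eq_sum_range_succ (fun i j => L.choose i * M.choose j),
    Finset.mul_sum]
  · refine Finset.sum_congr rfl fun i _ => ?_
    have h : (r + L).choose (r + i) * (r + i).choose r = (r + L).choose r * L.choose i := by
      simpa using Nat.choose_mul (n := r + L) (k := r + i) (s := r) (by lia)
    rw [Nat.add_sub_add_left, Nat.descFactorial_eq_factorial_mul_choose,
      Nat.descFactorial_eq_factorial_mul_choose]
    linear_combination (r ! * M.choose (s - i)) * h
  · intro k hk
    rw [Nat.descFactorial_of_lt (Finset.mem_range.mp hk), mul_zero]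

theorem ascPochhammer_eval_neg_natCast (a j : ℕ) :
    (ascPochhammer ℝ j).eval (-(a : ℝ)) = (-1) ^ j * (a.descFactorial j : ℝ) := by
  rw [ascPochhammer_eval_neg_eq_descPochhammer, descPochhammer_eval_eq_descFactorial]

/-- The coefficients of the hypergeometric polynomial are the values of the probability mass
function, for `K = m + a`, `N - K = b`, `n = m + b`. -/
theorem hypergeometric_coeff_eq (m a b j : ℕ) (ha : j ≤ a) (hb : j ≤ b) :
    ((m + b)! : ℝ) * ((m + a)! : ℝ) / (((m + a + b)! : ℝ) * (m ! : ℝ)) *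
      (((ascPochhammer ℝ j).eval (-(a : ℝ)) * (ascPochhammer ℝ j).eval (-(b : ℝ))) /
        ((ascPochhammer ℝ j).eval ((m : ℝ) + 1) * (j ! : ℝ)))
    = ((m + a).choose (m + j) * b.choose (m + b - (m + j)) : ℝ)
        / ((m + a + b).choose (m + b) : ℝ) := by
  have hasc : (ascPochhammer ℝ j).eval ((m : ℝ) + 1) = ((m + 1).ascFactorial j : ℝ) := by
    rw [← ascPochhammer_nat_eq_ascFactorial, ← Nat.cast_add_one, ascPochhammer_eval_cast]
  have hm : (m ! : ℝ) * ((m + 1).ascFactorial j : ℝ) = ((m + j)! : ℝ) := by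
    exact_mod_cast Nat.factorial_mul_ascFactorial m j
  have hda : ((a - j)! : ℝ) * (a.descFactorial j : ℝ) = (a ! : ℝ) := by
    exact_mod_cast Nat.factorial_mul_descFactorial ha
  have hdb : ((b - j)! : ℝ) * (b.descFactorial j : ℝ) = (b ! : ℝ) := by
    exact_mod_cast Nat.factorial_mul_descFactorial hb
  have hsq : ((-1 : ℝ) ^ j) * (-1) ^ j = 1 := by rw [← mul_pow]; simp
  have f0 : ∀ k : ℕ, (k ! : ℝ) ≠ 0 := fun k => by positivity
  rw [ascPochhammer_eval_neg_natCast, ascPochhammer_eval_neg_natCast, hasc,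
    Nat.cast_choose ℝ (show m + j ≤ m + a by lia),
    Nat.cast_choose ℝ (show m + b - (m + j) ≤ b by lia),
    Nat.cast_choose ℝ (show m + b ≤ m + a + b by lia),
    show m + a - (m + j) = a - j by lia, show m + b - (m + j) = b - j by lia,
    show b - (b - j) = j by lia, show m + a + b - (m + b) = a by lia, ← hm, ← hda, ← hdb]
  have hA : ((m + 1).ascFactorial j : ℝ) ≠ 0 := right_ne_zero_of_mul (hm ▸ f0 _)
  have hA' : (a.descFactorial j : ℝ) ≠ 0 := right_ne_zero_of_mul (hda ▸ f0 _)
  have hB' : (b.descFactorial j : ℝ) ≠ 0 := right_ne_zero_of_mul (hdb ▸ f0 _)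
  have h1 := f0 m
  have h2 := f0 (m + a)
  have h3 := f0 (m + b)
  have h4 := f0 (m + a + b)
  have h5 := f0 j
  have h6 := f0 (a - j)
  have h7 := f0 (b - j)
  rw [mul_mul_mul_comm, hsq, one_mul]
  field_simp

theorem sum_range_eq_sum_range_shift (m a b : ℕ) (z : ℝ) :
    ∑ k ∈ Finset.range (m + b + 1),
        ((m + a).choose k * b.choose (m + b - k) : ℝ) * z ^ k
      = ∑ j ∈ Finset.range (min a b + 1),
        ((m + a).choose (m + j) * b.choose (m + b - (m + j)) : ℝ) * z ^ (m + j) := by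
  rw [add_assoc, Finset.sum_range_add, Finset.sum_eq_zero, zero_add]
  · refine (Finset.sum_subset (Finset.range_mono (by lia)) fun j hj hj' => ?_).symm
    rw [Finset.mem_range] at hj hj'
    rw [Nat.choose_eq_zero_of_lt (show m + a < m + j by lia)]
    simp
  · intro k hk
    rw [Finset.mem_range] at hk
    rw [Nat.choose_eq_zero_of_lt (show b < m + b - k by lia)]
    simp

theorem iteratedDeriv_sum_mul_pow_one (c : ℕ → ℝ) (d r : ℕ) :
    iteratedDeriv r (fun z : ℝ => ∑ k ∈ Finset.range d, c k * z ^ k) 1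
      = ∑ k ∈ Finset.range d, c k * (k.descFactorial r : ℝ) := by
  rw [iteratedDeriv_fun_sum fun k _ => by fun_prop]
  refine Finset.sum_congr rfl fun k _ => ?_
  rw [iteratedDeriv_const_mul_field, iteratedDeriv_eq_iterate, iter_deriv_pow,
    ← descPochhammer_eval_eq_descFactorial, descPochhammer_eval_eq_prod_range]
  simp

theorem hypergeometric_factorial_moment_from_corrected_pgf (N K n r : ℕ) (hKN : K ≤ N)
    (hnN : n ≤ N) (hn : N - K + 1 ≤ n) (hr : r ≤ min n K) :
    iteratedDeriv r
      (fun z : ℝ =>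
        (n ! : ℝ) * (K ! : ℝ) / ((N ! : ℝ) * ((n + K - N)! : ℝ)) * z ^ (n + K - N) *
          ∑ j ∈ Finset.range (min (N - n) (N - K) + 1),
            ((ascPochhammer ℝ j).eval ((n : ℝ) - (N : ℝ)) *
                (ascPochhammer ℝ j).eval ((K : ℝ) - (N : ℝ))) /
              ((ascPochhammer ℝ j).eval ((n : ℝ) + (K : ℝ) - (N : ℝ) + 1) * (j ! : ℝ)) *
              z ^ j) 1
    = (n ! : ℝ) * (K ! : ℝ) * ((N - r)! : ℝ) /
        (((n - r)! : ℝ) * ((K - r)! : ℝ) * (N ! : ℝ)) := by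
  obtain ⟨m, a, b, rfl, rfl, rfl⟩ : ∃ m a b, N = m + a + b ∧ K = m + a ∧ n = m + b :=
    ⟨n + K - N, N - n, N - K, by lia, by lia, by lia⟩
  rw [le_min_iff] at hr
  obtain ⟨hrn, hrK⟩ := hr
  rw [show m + b + (m + a) - (m + a + b) = m by lia, show m + a + b - (m + b) = a by lia,
    show m + a + b - (m + a) = b by lia,
    show ((m + b : ℕ) : ℝ) - ((m + a + b : ℕ) : ℝ) = -(a : ℝ) by push_cast; ring,
    show ((m + a : ℕ) : ℝ) - ((m + a + b : ℕ) : ℝ) = -(b : ℝ) by push_cast; ring,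
    show ((m + b : ℕ) : ℝ) + ((m + a : ℕ) : ℝ) - ((m + a + b : ℕ) : ℝ) + 1 = (m : ℝ) + 1 by
      push_cast; ring]
  have hfun : (fun z : ℝ =>
        ((m + b)! : ℝ) * ((m + a)! : ℝ) / (((m + a + b)! : ℝ) * (m ! : ℝ)) * z ^ m *
          ∑ j ∈ Finset.range (min a b + 1),
            ((ascPochhammer ℝ j).eval (-(a : ℝ)) * (ascPochhammer ℝ j).eval (-(b : ℝ))) /
              ((ascPochhammer ℝ j).eval ((m : ℝ) + 1) * (j ! : ℝ)) * z ^ j)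
      = fun z : ℝ => ((m + a + b).choose (m + b) : ℝ)⁻¹ *
          ∑ k ∈ Finset.range (m + b + 1),
            ((m + a).choose k * b.choose (m + b - k) : ℝ) * z ^ k := by
    funext z
    rw [sum_range_eq_sum_range_shift, Finset.mul_sum, Finset.mul_sum]
    refine Finset.sum_congr rfl fun j hj => ?_
    rw [Finset.mem_range] at hj
    linear_combination z ^ (m + j) * hypergeometric_coeff_eq m a b j (by lia) (by lia)
  have hsum : ∑ k ∈ Finset.range (m + b + 1),
      ((m + a).choose k * b.choose (m + b - k) : ℝ) * (k.descFactorial r : ℝ)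
        = ((m + a).descFactorial r : ℝ) * ((m + a + b - r).choose (m + b - r) : ℝ) := by
    exact_mod_cast sum_choose_mul_choose_mul_descFactorial (m + a) b (m + b) r hrK hrn
  have hd : ((m + a - r)! : ℝ) * ((m + a).descFactorial r : ℝ) = ((m + a)! : ℝ) := by
    exact_mod_cast Nat.factorial_mul_descFactorial hrK
  rw [hfun, iteratedDeriv_const_mul_field, iteratedDeriv_sum_mul_pow_one, hsum, ← hd,
    Nat.cast_choose ℝ (show m + b - r ≤ m + a + b - r by lia),
    Nat.cast_choose ℝ (show m + b ≤ m + a + b by lia),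
    show m + a + b - r - (m + b - r) = a by lia, show m + a + b - (m + b) = a by lia]
  have f0 : ∀ k : ℕ, (k ! : ℝ) ≠ 0 := fun k => by positivity
  have h1 := f0 (m + a - r)
  have h2 := f0 (m + b - r)
  have h3 := f0 (m + b)
  have h4 := f0 (m + a + b)
  have h5 := f0 a
  field_simp
end
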